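/- arXiv:1405.7709 — 2 statements merged into one kernel-verified Lean document; each statement's English description precedes it below -/
import Mathlib

section
/- Fix 0 < δ ≤ 1 and n ∈ ℕ such that n/2 and δn/2 are integers, and fix indices 1 ≤ α, β ≤ δn/2. Let μ₁ = {(w_{i+n/2}, m_i) : 1 ≤ i ≤ n/2} ∪ {(w_i, m_{i+n/2}) : 1 ≤ i ≤ n/2} and let μ₀ = {(w_α, m_β)} ∪ {(w_i, m_{i+n/2}) : i < α} ∪ {(w_{i+n/2}, m_i) : i < β} ∪ {(w_i, m_{i+n/2−1}) : α < i ≤ n/2} ∪ {(w_{i+n/2−1}, m_i) : β < i ≤ n/2} ∪ {(w_n, m_n)} be perfect marriages between W = {w_1, …, w_n} and M = {m_1, …, m_n}. Then the divorce distance satisfies d(μ₀, μ₁) ≥ (1 − δ)n. -/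
/-- The perfect marriage `μ₁` (0-indexed, with `n = 2 * k`): woman `i` marries man
`(i + k) mod n`, i.e. `w_i ↔ m_{i + n/2}` for `1 ≤ i ≤ n/2` and `w_{i + n/2} ↔ m_i`
for `1 ≤ i ≤ n/2` in the 1-indexed notation of the paper. -/
def muOne (n k : ℕ) : Fin n → Fin n :=
  fun i => ⟨(i.val + k) % n, Nat.mod_lt _ (Nat.lt_of_le_of_lt (Nat.zero_le _) i.isLt)⟩

/-- The 0-indexed man that the marriage `μ₀` assigns to the 0-indexed woman `u`,
where `n = 2 * k` and `a = α - 1`, `b = β - 1` are the 0-indexed intersection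
indices.  In the 1-indexed notation of the paper: `w_α ↔ m_β`; `w_i ↔ m_{i + n/2}`
for `i < α`; `w_{i + n/2} ↔ m_i` for `i < β`; `w_i ↔ m_{i + n/2 - 1}` for
`α < i ≤ n/2`; `w_{i + n/2 - 1} ↔ m_i` for `β < i ≤ n/2`; and `w_n ↔ m_n`. -/
def muZeroVal (k a b u : ℕ) : ℕ :=
  if u = a then b
  else if u < a then u + k
  else if u < k then u + k - 1
  else if u < k + b then u - k
  else if u + 2 ≤ 2 * k then u + 1 - k
  else 2 * k - 1

/-- The perfect marriage `μ₀` as a map `Fin n → Fin n` (for `n = 2 * k` and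
`a, b < n/2` the reduction modulo `n` is the identity on all values taken). -/
def muZero (n k a b : ℕ) : Fin n → Fin n :=
  fun u => ⟨muZeroVal k a b u.val % n,
    Nat.mod_lt _ (Nat.lt_of_le_of_lt (Nat.zero_le _) u.isLt)⟩

/-- The divorce distance `d(μ, μ') = n - |μ ∩ μ'|` between two perfect marriages,
where `|μ ∩ μ'|` is the number of couples married in both `μ` and `μ'`. -/
def divorceDist (n : ℕ) (μ μ' : Fin n → Fin n) : ℕ :=
  n - (Finset.univ.filter (fun i => μ i = μ' i)).card

/-- The divorce distance between the marriages `μ₀` and `μ₁` is at least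
`(1 - δ) n`.  Here `n = 2 * k`, `0 < δ ≤ 1`, `h = δn/2` (so `h ≤ k`), and
`a = α - 1 < h`, `b = β - 1 < h` are the 0-indexed versions of the fixed indices
`1 ≤ α, β ≤ δn/2`. -/
theorem divorceDist_muZero_muOne (n k h a b : ℕ) (δ : ℝ)
    (hn : n = 2 * k) (hδ0 : 0 < δ) (hδ1 : δ ≤ 1)
    (hh : (h : ℝ) = δ * n / 2) (hhk : h ≤ k)
    (ha : a < h) (hb : b < h) :
    ((divorceDist n (muZero n k a b) (muOne n k) : ℝ)) ≥ (1 - δ) * n := by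
  have hcard : (Finset.univ.filter
      (fun i => muZero n k a b i = muOne n k i)).card ≤ a + b := by
    have hsub : (Finset.univ.filter (fun i => muZero n k a b i = muOne n k i)).image Fin.val
        ⊆ Finset.range a ∪ Finset.Ico k (k + b) := by
      intro x hx
      simp only [Finset.mem_image, Finset.mem_filter, Finset.mem_univ, true_and] at hx
      obtain ⟨i, hi, rfl⟩ := hx
      have hlt := i.isLt
      have hv : muZeroVal k a b i.val % n = (i.val + k) % n := congrArg Fin.val hi
      simp only [Finset.mem_union, Finset.mem_range, Finset.mem_Ico]
      generalize i.val = u at *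
      have h1 : muZeroVal k a b u < n := by
        unfold muZeroVal
        split_ifs <;> omega
      rw [Nat.mod_eq_of_lt h1] at hv
      have h2 : (u + k) % n = if u < k then u + k else u - k := by
        split_ifs with hu
        · exact Nat.mod_eq_of_lt (by omega)
        · have : u + k = (u - k) + n := by omega
          rw [this, Nat.add_mod_right]
          exact Nat.mod_eq_of_lt (by omega)
      rw [h2] at hv
      unfold muZeroVal at hv
      split_ifs at hv <;> omega
    rw [← Finset.card_image_of_injective _ Fin.val_injective]
    refine (Finset.card_le_card hsub).trans ((Finset.card_union_le _ _).trans ?_)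
    simp
  have hnat : n ≤ divorceDist n (muZero n k a b) (muOne n k) + 2 * h := by
    unfold divorceDist
    omega
  have hreal : (n : ℝ) ≤ (divorceDist n (muZero n k a b) (muOne n k) : ℝ) + 2 * h := by
    exact_mod_cast hnat
  rw [hh] at hreal
  linarith
end

section
/- Consider the three-tier construction with parameter δ and Boolean vectors x, y, and suppose the instance is uniquely intersecting with intersection (α, β), i.e., (α, β) is the only pair with x^α_β = y^α_β = 1. Then every stable perfect marriage for these preference lists contains the pair (w_α, m_β). -/
/-- Stability of a perfect marriage in a marriage market with full preference lists.
Women and men are both indexed by `Fin n`; `μ i` is the man married to woman `i`.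
`wR i j` is woman `i`'s rank of man `j` (lower rank = more preferred) and `mR j i`
is man `j`'s rank of woman `i`.  The marriage is stable when it is a bijection and
there is no blocking pair: no woman `i` and man `μ i'` (married to woman `i'`) such
that woman `i` prefers `μ i'` over her spouse `μ i` and man `μ i'` prefers `i` over
his spouse `i'`. -/
def StableFull (n : ℕ) (wR mR : ℕ → ℕ → ℕ) (μ : Fin n → Fin n) : Prop :=
  Function.Bijective μ ∧
    ∀ i i' : Fin n,
      ¬(wR i.val (μ i').val < wR i.val (μ i).val ∧
        mR (μ i').val i.val < mR (μ i').val i'.val)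

/-- Women's ranks in the three-tier construction, 0-indexed, with `n = 2 * k` and
`h = δn/2`: women/men with index `< h` are high, those in `[h, k)` are mid, and
those in `[k, n)` are low.  A low woman ranks the men in index order.  A mid woman
ranks the low men first (in index order) and then `m_1, …, m_{n/2}` (in index
order).  A high woman `i` ranks first the high men `j` with `x i j = 1`, then the
low men, then the mid men, then the high men `j` with `x i j = 0`, each group
sorted by index.  (Lower rank = more preferred.) -/
def tierWRank (n k h : ℕ) (x : ℕ → ℕ → Bool) (i j : ℕ) : ℕ :=
  if k ≤ i then j
  else if h ≤ i then (if k ≤ j then j - k else j + k)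
  else (if j < h ∧ x i j = true then 0
        else if k ≤ j then 1
        else if h ≤ j then 2
        else 3) * n + j

/-- Men's ranks in the three-tier construction, symmetric to `tierWRank`: a high
man `j` ranks first the high women `i` with `y i j = 1`, then the low women, then
the mid women, then the remaining high women, each group sorted by index. -/
def tierMRank (n k h : ℕ) (y : ℕ → ℕ → Bool) (j i : ℕ) : ℕ :=
  if k ≤ j then i
  else if h ≤ j then (if k ≤ i then i - k else i + k)
  else (if i < h ∧ y i j = true then 0
        else if k ≤ i then 1
        else if h ≤ i then 2
        else 3) * n + i

theorem tier_cover {n : ℕ} (μ : Fin n → Fin n) (hμ : Function.Injective μ)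
    (S T : Finset (Fin n)) (hc : T.card ≤ S.card) (hST : ∀ i ∈ S, μ i ∈ T)
    (i : Fin n) (hi : μ i ∈ T) : i ∈ S := by
  have hsub : S.image μ ⊆ T := by
    intro t ht
    obtain ⟨s, hs, rfl⟩ := Finset.mem_image.1 ht
    exact hST s hs
  have heq : S.image μ = T :=
    Finset.eq_of_subset_of_card_le hsub (by rwa [Finset.card_image_of_injective _ hμ])
  rw [← heq] at hi
  obtain ⟨s, hs, h⟩ := Finset.mem_image.1 hi
  exact hμ h ▸ hs

theorem tier_card (n k : ℕ) (hn : n = 2 * k) :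
    (Finset.univ.filter (fun i : Fin n => i.val < k)).card =
    (Finset.univ.filter (fun i : Fin n => k ≤ i.val)).card := by
  apply Finset.card_bij (fun i hi => ⟨i.val + k, by
    have := (Finset.mem_filter.1 hi).2; omega⟩)
  · intro i hi; simp
  · intro i _ j _ hij
    simp only [Fin.mk.injEq] at hij
    apply Fin.ext; omega
  · intro j hj
    have h1 := (Finset.mem_filter.1 hj).2
    have h2 := j.isLt
    refine ⟨⟨j.val - k, by omega⟩, by simp; omega, ?_⟩
    apply Fin.ext; simp; omega

/-- In the three-tier construction with a uniquely-intersecting instance whose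
unique intersection is the pair of high indices `(a, b)` (0-indexed; `(α, β)` in
the 1-indexed notation of the paper), every stable perfect marriage marries
`w_α` to `m_β`. -/
theorem tier_unique_intersection_married (n k h a b : ℕ) (δ : ℝ)
    (x y : ℕ → ℕ → Bool)
    (hn : n = 2 * k) (hδ0 : 0 < δ) (hδ1 : δ ≤ 1)
    (hh : (h : ℝ) = δ * n / 2) (hhk : h ≤ k)
    (ha : a < h) (hb : b < h)
    (hxy : x a b = true ∧ y a b = true)
    (huniq : ∀ i j : ℕ, i < h → j < h → x i j = true → y i j = true → i = a ∧ j = b) :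
    ∀ μ : Fin n → Fin n,
      StableFull n (tierWRank n k h x) (tierMRank n k h y) μ →
      μ ⟨a, by omega⟩ = ⟨b, by omega⟩ := by
  rintro μ ⟨hbij, hst⟩
  have hc := tier_card n k hn
  by_contra hne
  -- a low-low couple and a couple without low members cannot coexist
  have key : ∀ i l : Fin n, i.val < k → (μ i).val < k → k ≤ l.val → k ≤ (μ l).val → False := by
    intro i l hi hj hl hml
    have B1 := hst i l
    have B2 := hst l i
    have hnot : ¬ (i.val = a ∧ (μ i).val = b) := by
      rintro ⟨h1, h2⟩
      apply hne
      have : i = ⟨a, by omega⟩ := Fin.ext h1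
      rw [← this]
      exact Fin.ext h2
    have hu := huniq i.val (μ i).val
    have l1 := i.isLt
    have l2 := (μ i).isLt
    have l3 := l.isLt
    have l4 := (μ l).isLt
    by_cases hx : i.val < h ∧ (μ i).val < h ∧ x i.val (μ i).val = true
    · obtain ⟨h1, h2, h3⟩ := hx
      have hy : ¬ (y i.val (μ i).val = true) := fun h4 => hnot (hu h1 h2 h3 h4)
      apply B2
      unfold tierWRank tierMRank
      constructor
      · rw [if_pos hl, if_pos hl]; omega
      · rw [if_neg (by omega), if_neg (by omega), if_neg (by omega), if_pos hl,
          if_neg (by omega), if_neg (by omega), if_neg (by tauto), if_neg (by omega),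
          if_neg (by omega)]
        omega
    · apply B1
      unfold tierWRank tierMRank
      constructor
      · have hki : ¬ k ≤ i.val := by omega
        rw [if_neg hki, if_neg hki]
        by_cases hm : h ≤ i.val
        · rw [if_pos hm, if_pos hm, if_pos hml, if_neg (by omega)]; omega
        · rw [if_neg hm, if_neg hm, if_neg (by omega), if_pos hml,
            if_neg (fun hh => hx ⟨by omega, hh⟩), if_neg (by omega)]
          split_ifs <;> omega
      · rw [if_pos hml, if_pos hml]; omega
  -- any low-low couple yields a couple without low members
  have noLL : ∀ l : Fin n, k ≤ l.val → (μ l).val < k := by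
    intro l hl
    by_contra hml
    have hex : ∀ i : Fin n, i.val < k → k ≤ (μ i).val := fun i hi => by
      by_contra hj
      exact key i l hi (by omega) hl (by omega)
    have := tier_cover μ hbij.1 _ _ hc.ge (fun i hi => by
      simp only [Finset.mem_filter, Finset.mem_univ, true_and] at hi ⊢
      exact hex i hi) l (by simp; omega)
    simp at this
    omega
  have noHH : ∀ i : Fin n, (μ i).val < k → k ≤ i.val := by
    intro i hi
    have := tier_cover μ hbij.1 _ _ hc.le (fun i hi => by
      simp only [Finset.mem_filter, Finset.mem_univ, true_and] at hi ⊢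
      exact noLL i hi) i (by simp; omega)
    simpa using this
  obtain ⟨c, hcb⟩ := hbij.2 ⟨b, by omega⟩
  have hcv : (μ c).val = b := by rw [hcb]
  have hck : k ≤ c.val := noHH c (by omega)
  have hak : k ≤ (μ ⟨a, by omega⟩).val := by
    by_contra hlt
    have := noHH ⟨a, by omega⟩ (by omega)
    simp at this
    omega
  apply hst ⟨a, by omega⟩ c
  have l1 := c.isLt
  rw [hcv]
  unfold tierWRank tierMRank
  constructor
  · rw [if_neg (by simp; omega), if_neg (by simp; omega), if_pos ⟨hb, hxy.1⟩,
      if_neg (by simp; omega), if_neg (by simp; omega), if_neg (by omega), if_pos hak]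
    omega
  · rw [if_neg (by omega), if_neg (by omega), if_pos ⟨ha, hxy.2⟩,
      if_neg (by omega), if_neg (by omega), if_neg (by omega), if_pos hck]
    simp only []
    omega
end
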